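/- Let P be a poset whose order is the intersection of finitely many scattered linear orders; that is, there exist n : ℕ and linear orders r 1, …, r n on the underlying set of P, none of which admits an order embedding of ℚ, such that for all a, b one has a ≤ b ↔ (for every i, r i a b). Then there is no injective map f : (List Bool) × Bool → P such that f (l, i) ≤ f (l', j) ↔ ((l, i) = (l', j), or (l is a proper prefix of l' and i = false and j = true)) — that is, the open split B(Ť₂) of the binary tree does not embed into P — and there is no injective map g : (List Bool) × Bool → P satisfying the same equivalence with g (l', j) ≤ g (l, i) on the left-hand side (the dual of B(Ť₂) does not embed into P). -/

import Mathlib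

/-- A relation on `α` is scattered when there is no order embedding of `ℚ` into it. -/
def NoRatEmbedRel {α : Type*} (r : α → α → Prop) : Prop :=
  ¬ ∃ f : ℚ → α, ∀ q q' : ℚ, q ≤ q' ↔ r (f q) (f q')

/-- A linear order carrying a monotone relation `Q` every instance of which can be split by an
intermediate point contains a copy of `ℚ`. -/
theorem nonempty_rat_orderEmbedding_of_split {L : Type*} [LinearOrder L] {Q : L → L → Prop}
    (hmono : ∀ {p q p' q'}, p' ≤ p → q ≤ q' → Q p q → Q p' q')
    (hsplit : ∀ {p q}, Q p q → ∃ m, p < m ∧ m < q ∧ Q p m ∧ Q m q)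
    {p q : L} (hpq : p < q) (hQ : Q p q) : Nonempty (ℚ ↪o L) := by
  let S : Set (Set L) := {K | ∀ x ∈ K, ∀ y ∈ K, x < y → Q x y}
  have hbase : ({p, q} : Set L) ∈ S := by
    rintro x (rfl | rfl) y (rfl | rfl) hxy
    · exact absurd hxy (lt_irrefl _)
    · exact hQ
    · exact absurd hxy hpq.not_gt
    · exact absurd hxy (lt_irrefl _)
  obtain ⟨K, hK, hmax⟩ := zorn_subset_nonempty S (by
    intro c hc hchain _
    refine ⟨⋃₀ c, ?_, fun s hs => Set.subset_sUnion_of_mem hs⟩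
    rintro x ⟨s, hs, hx⟩ y ⟨t, ht, hy⟩ hxy
    rcases hchain.total hs ht with h | h
    · exact hc ht x (h hx) y hy hxy
    · exact hc hs x hx y (h hy) hxy) _ hbase
  have hdense : DenselyOrdered K := by
    refine ⟨fun ⟨x, hx⟩ ⟨y, hy⟩ hxy => ?_⟩
    by_contra! hgap
    have hgap' (z : L) (hz : z ∈ K) : z ≤ x ∨ y ≤ z := by
      rcases le_or_gt z x with h | h
      · exact Or.inl h
      · exact Or.inr (hgap ⟨z, hz⟩ h)
    obtain ⟨m, hxm, hmy, hQx, hQy⟩ := hsplit (hmax.prop x hx y hy hxy)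
    have hins : insert m K ∈ S := by
      rintro u (rfl | hu) v (rfl | hv) huv
      · exact absurd huv (lt_irrefl _)
      · exact hmono le_rfl ((hgap' v hv).resolve_left (hxm.trans huv).not_ge) hQy
      · exact hmono ((hgap' u hu).resolve_right (huv.trans hmy).not_ge) le_rfl hQx
      · exact hmax.prop u hu v hv huv
    have hmK : m ∈ K := hmax.le_of_ge hins (Set.subset_insert m K) (Set.mem_insert m K)
    exact (hgap' m hmK).elim hxm.not_ge hmy.not_ge
  have hnontrivial : Nontrivial K :=
    ⟨⟨⟨p, hK (by simp)⟩, ⟨q, hK (by simp)⟩, fun h => hpq.ne (congrArg Subtype.val h)⟩⟩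
  obtain ⟨e⟩ := Order.embedding_from_countable_to_dense ℚ K
  exact ⟨e.trans (OrderEmbedding.subtype (· ∈ K))⟩

theorem List.ne_of_concat_prefix_left {β : Type*} {l m : List β} {c : β}
    (h : l ++ [c] <+: m) : l ≠ m := by
  rintro rfl
  simpa using h.length_le

/-- Let `a` and `b` map the binary tree to a linear order without copies of `ℚ`, with
`a l ≤ b m` for every proper prefix `l` of `m`. Then above every node there is a node `u` such
that, for all `x` and `y` above `u`, the value `a x` is at most `b` on some cone above `y`. -/
theorem exists_prefix_forall_le_on_cone {L : Type*} [LinearOrder L] (hL : IsEmpty (ℚ ↪o L))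
    {a b : List Bool → L} (hab : ∀ l m, l <+: m → l ≠ m → a l ≤ b m) (v : List Bool) :
    ∃ u, v <+: u ∧ ∀ x y, u <+: x → u <+: y →
      ∃ y', y <+: y' ∧ ∀ z, y' <+: z → a x ≤ b z := by
  by_contra! hfail
  have hcone {x y : List Bool} (h : ∀ y', y <+: y' → ∃ z, y' <+: z ∧ b z < a x)
      (w : List Bool) (hw : y <+: w) : a w < a x := by
    obtain ⟨z, hz, hlt⟩ := h (w ++ [false]) (hw.trans (List.prefix_append _ _))
    exact (hab w z ((List.prefix_append _ _).trans hz)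
      (List.ne_of_concat_prefix_left hz)).trans_lt hlt
  have hlower (x w : List Bool) (hw : x ++ [false] <+: w) : a x ≤ b w :=
    hab x w ((List.prefix_append _ _).trans hw) (List.ne_of_concat_prefix_left hw)
  let Q : L → L → Prop := fun p q => ∃ u, v <+: u ∧ ∀ w, u <+: w → a w < q ∧ p ≤ b w
  obtain ⟨x, y, hx, hy, hxy⟩ := hfail v (List.prefix_refl v)
  refine hL.elim (nonempty_rat_orderEmbedding_of_split (Q := Q) ?_ ?_
    (hcone hxy y (List.prefix_refl y)) ?_).some
  · rintro p q p' q' hp hq ⟨u, hu, h⟩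
    exact ⟨u, hu, fun w hw => ⟨(h w hw).1.trans_le hq, hp.trans (h w hw).2⟩⟩
  · rintro p q ⟨u, hu, h⟩
    obtain ⟨x, y, hx, hy, hxy⟩ := hfail u hu
    obtain ⟨z, hz, hlt⟩ := hxy y (List.prefix_refl y)
    refine ⟨a x, (h z (hy.trans hz)).2.trans_lt hlt, (h x hx).1,
      ⟨y, hu.trans hy, fun w hw => ⟨hcone hxy w hw, (h w (hy.trans hw)).2⟩⟩,
      ⟨x ++ [false], (hu.trans hx).trans (List.prefix_append _ _), fun w hw =>
        ⟨(h w (hx.trans ((List.prefix_append _ _).trans hw))).1, hlower x w hw⟩⟩⟩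
  · exact ⟨y ++ [false], hy.trans (List.prefix_append _ _), fun w hw =>
      ⟨hcone hxy w ((List.prefix_append _ _).trans hw), hlower y w hw⟩⟩

/-- If finitely many properties of nodes are closed under extension and each of them holds
somewhere above every node of a cone, then they hold simultaneously above the root of the cone. -/
theorem exists_prefix_forall_of_dense {β ι : Type*} [Finite ι] {p : ι → List β → Prop} (v : List β)
    (hmono : ∀ i l m, l <+: m → p i l → p i m)
    (hdense : ∀ i l, v <+: l → ∃ m, l <+: m ∧ p i m) : ∃ u, v <+: u ∧ ∀ i, p i u := by
  classical
  have := Fintype.ofFinite ι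
  suffices h : ∀ s : Finset ι, ∃ u, v <+: u ∧ ∀ i ∈ s, p i u by
    simpa using h Finset.univ
  intro s
  induction s using Finset.induction_on with
  | empty => exact ⟨v, List.prefix_refl v, by simp⟩
  | insert i s _ ih =>
    obtain ⟨u, hvu, hu⟩ := ih
    obtain ⟨m, hum, hm⟩ := hdense i u hvu
    refine ⟨m, hvu.trans hum, fun j hj => ?_⟩
    rcases Finset.mem_insert.mp hj with rfl | hj
    · exact hm
    · exact hmono j u m hum (hu j hj)

/-- A relational form of `exists_prefix_forall_le_on_cone`. -/
theorem NoRatEmbedRel.exists_prefix_forall_rel_on_cone {α : Type*} {r : α → α → Prop}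
    (hlin : IsLinearOrder α r) (hscat : NoRatEmbedRel r) {a b : List Bool → α}
    (hab : ∀ l m, l <+: m → l ≠ m → r (a l) (b m)) (v : List Bool) :
    ∃ u, v <+: u ∧ ∀ x y, u <+: x → u <+: y →
      ∃ y', y <+: y' ∧ ∀ z, y' <+: z → r (a x) (b z) := by
  classical
  let _ : LinearOrder α :=
    { le := r
      le_refl := hlin.refl
      le_trans := hlin.trans
      le_antisymm := hlin.antisymm
      le_total := hlin.total
      toDecidableLE := Classical.decRel _ }
  exact exists_prefix_forall_le_on_cone
    ⟨fun e => hscat ⟨e, fun _ _ => e.le_iff_le.symm⟩⟩ hab v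

theorem NoRatEmbedRel.swap {α : Type*} {r : α → α → Prop} (h : NoRatEmbedRel r) :
    NoRatEmbedRel (Function.swap r) := by
  rintro ⟨f, hf⟩
  refine h ⟨fun q => f (-q), fun q q' => ?_⟩
  rw [← neg_le_neg_iff]
  exact hf (-q') (-q)

/-- The open split of the binary tree is not an intersection of pullbacks of finitely many
scattered linear orders. -/
theorem not_inter_scattered_rel_openSplit {α ι : Type*} [Finite ι] {r : ι → α → α → Prop}
    (hlin : ∀ i, IsLinearOrder α (r i)) (hscat : ∀ i, NoRatEmbedRel (r i))
    (f : (List Bool) × Bool → α) :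
    ¬ ∀ p p' : (List Bool) × Bool, (∀ i, r i (f p) (f p')) ↔
      (p = p' ∨ (p.1 <+: p'.1 ∧ p.1 ≠ p'.1 ∧ p.2 = false ∧ p'.2 = true)) := by
  intro hf
  have hab (i : ι) (l m : List Bool) (hlm : l <+: m) (hne : l ≠ m) :
      r i (f (l, false)) (f (m, true)) :=
    (hf (l, false) (m, true)).mpr (Or.inr ⟨hlm, hne, rfl, rfl⟩) i
  obtain ⟨u, -, hu⟩ := exists_prefix_forall_of_dense
    (p := fun i u => ∀ x y, u <+: x → u <+: y →
      ∃ y', y <+: y' ∧ ∀ z, y' <+: z → r i (f (x, false)) (f (z, true))) []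
    (fun _ _ _ hlm h x y hx hy => h x y (hlm.trans hx) (hlm.trans hy))
    (fun i l _ => (hscat i).exists_prefix_forall_rel_on_cone (hlin i) (hab i) l)
  obtain ⟨z, hz, hrz⟩ := exists_prefix_forall_of_dense
    (p := fun i y => ∀ z, y <+: z → r i (f (u ++ [false], false)) (f (z, true))) (u ++ [true])
    (fun _ _ _ hlm h z hz => h z (hlm.trans hz))
    (fun i y hy => hu i _ y (List.prefix_append _ _) ((List.prefix_append _ _).trans hy))
  rcases (hf (u ++ [false], false) (z, true)).mp fun i => hrz i z (List.prefix_refl z) with h | h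
  · simp at h
  · have heq := List.IsPrefix.eq_of_length (List.prefix_of_prefix_length_le h.1 hz (by simp))
      (by simp)
    simp at heq

/-- If the order of a poset `P` is the intersection of finitely many scattered linear
orders, then neither the open split `B(Ť₂)` of the binary tree `T₂ = (List Bool, <+:)`
(that is, `List Bool × Bool` ordered by `(l, i) ≤ (l', j) ↔ (l, i) = (l', j) ∨`
(`l` a proper prefix of `l'` and `i = false`, `j = true`)) nor its dual embeds into `P`. -/
theorem open_split_tree_not_embeddable_of_inter_scattered_linear_orders
    {α : Type*} [PartialOrder α] (n : ℕ) (r : Fin n → α → α → Prop)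
    (hlin : ∀ i, IsLinearOrder α (r i))
    (hscat : ∀ i, NoRatEmbedRel (r i))
    (hint : ∀ a b : α, a ≤ b ↔ ∀ i, r i a b) :
    (¬ ∃ f : (List Bool) × Bool → α, Function.Injective f ∧
      ∀ p p' : (List Bool) × Bool, f p ≤ f p' ↔
        (p = p' ∨ (p.1 <+: p'.1 ∧ p.1 ≠ p'.1 ∧ p.2 = false ∧ p'.2 = true))) ∧
    (¬ ∃ g : (List Bool) × Bool → α, Function.Injective g ∧
      ∀ p p' : (List Bool) × Bool, g p' ≤ g p ↔
        (p = p' ∨ (p.1 <+: p'.1 ∧ p.1 ≠ p'.1 ∧ p.2 = false ∧ p'.2 = true))) := by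
  constructor
  · rintro ⟨f, -, hf⟩
    exact not_inter_scattered_rel_openSplit hlin hscat f fun p p' => by rw [← hint, hf]
  · rintro ⟨g, -, hg⟩
    refine not_inter_scattered_rel_openSplit (r := fun i => Function.swap (r i)) (fun i => ?_)
      (fun i => (hscat i).swap) g fun p p' => by rw [← hg, hint]
    have := hlin i
    exact
      { refl := fun x => refl_of (r i) x
        trans := fun _ _ _ h h' => trans_of (r i) h' h
        antisymm := fun _ _ h h' => antisymm_of (r i) h' h
        total := fun x y => total_of (r i) y x }
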